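/- For every integer k > 1, the number of domino tilings of the k × (k+1) rectangle N(k,k+1) has the same parity as the number of domino tilings of the (k−1) × k rectangle N(k−1,k). -/

import Mathlib

/-- Two cells of `ℤ × ℤ` are adjacent if they differ by `(1,0)` or `(0,1)`. -/
def Adjacent (a b : ℤ × ℤ) : Prop :=
  (a.1 = b.1 ∧ (a.2 = b.2 + 1 ∨ b.2 = a.2 + 1)) ∨
  (a.2 = b.2 ∧ (a.1 = b.1 + 1 ∨ b.1 = a.1 + 1))

/-- `T` is a domino tiling of `R`: a partition of `R` into two-element sets of adjacent cells. -/
def IsDominoTiling (R : Set (ℤ × ℤ)) (T : Set (Set (ℤ × ℤ))) : Prop :=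
  (∀ d ∈ T, ∃ a b, Adjacent a b ∧ d = {a, b}) ∧
  T.PairwiseDisjoint id ∧
  ⋃₀ T = R

/-- The number of domino tilings of `R`. -/
noncomputable def numTilings (R : Set (ℤ × ℤ)) : ℕ :=
  Nat.card {T : Set (Set (ℤ × ℤ)) // IsDominoTiling R T}

/-- The `a × b` rectangle of cells `N(a,b)`. -/
def rectN (a b : ℕ) : Set (ℤ × ℤ) :=
  {q | 0 ≤ q.1 ∧ q.1 < a ∧ 0 ≤ q.2 ∧ q.2 < b}

theorem kernel_zero (M : ℕ) (hM : 2 ≤ M) (f : ℤ → ℤ → ZMod 2)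
    (hx0 : ∀ y, f 0 y = 0) (hxM : ∀ y, f M y = 0)
    (hy0 : ∀ x, f x 0 = 0) (hyN : ∀ x, f x (M + 1) = 0)
    (hf : ∀ x y : ℤ, 0 < x → x < M → 0 < y → y < M + 1 →
      f (x+1) y + f (x-1) y + f x (y+1) + f x (y-1) = 0) :
    ∀ x y : ℤ, 0 ≤ x → x ≤ M → 0 ≤ y → y ≤ M + 1 → f x y = 0 := by
  have two : ∀ a : ZMod 2, a + a = 0 := by decide
  have eq_of : ∀ a b : ZMod 2, a + b = 0 → a = b := by decide
  -- the profile
  obtain ⟨c, hc⟩ : ∃ c : ℕ → ZMod 2, ∀ j, c (j+2) = c j + f (j+1) 1 := by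
    let p : ℕ → ZMod 2 × ZMod 2 := fun n =>
      Nat.rec (0, 0) (fun j q => (q.2, q.1 + f (j+1) 1)) n
    exact ⟨fun n => (p n).1, fun j => rfl⟩
  obtain ⟨g, geven, gper, gc⟩ : ∃ g : ℤ → ZMod 2, (∀ x, g (-x) = g x) ∧
      (∀ x, g (x + 2 * M) = g x) ∧ (∀ j : ℕ, j ≤ M → g j = c j) := by
    refine ⟨fun x => c (min (x % (2*M)) (2*M - x % (2*M))).toNat, ?_, ?_, ?_⟩
    · intro x
      have hpos : (0:ℤ) < 2 * M := by omega
      by_cases h : x % (2*M) = 0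
      · have : (-x) % (2*M) = 0 :=
          Int.emod_eq_zero_of_dvd ((Int.dvd_neg).2 (Int.dvd_of_emod_eq_zero h))
        simp only [h, this]
      · have : (-x) % (2*M) = 2*M - x % (2*M) := by
          have h1 := Int.emod_nonneg x hpos.ne'
          have h2 := Int.emod_lt_of_pos x hpos
          have h3 := Int.mul_ediv_add_emod x (2*M)
          have : -x = (2*M - x % (2*M)) + (2*M) * (-(x / (2*M)) - 1) := by
            linear_combination h3
          rw [this, Int.add_mul_emod_self_left, Int.emod_eq_of_lt] <;> omega
        simp only [this]
        congr 2
        rw [min_comm]; congr 1; ring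
    · intro x
      simp
    · intro j hj
      have : (j:ℤ) % (2*M) = j := Int.emod_eq_of_lt (by omega) (by omega)
      simp only [this]
      congr 1
      omega
  have gM : ∀ y, g (M + y) = g (M - y) := by
    intro y
    rw [← geven (M - y), ← gper (-(M - y))]; congr 1; ring
  have g1 : ∀ x : ℤ, 0 ≤ x → x ≤ M → g (x+1) + g (x-1) = f x 1 := by
    intro x h0 h1
    rcases h0.eq_or_lt with rfl | h0
    · rw [hx0, show (0:ℤ) - 1 = -(0+1) by ring, geven, two]
    rcases h1.eq_or_lt with rfl | h1
    · rw [hxM, gM, two]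
    obtain ⟨j, rfl⟩ : ∃ j : ℕ, x = j + 1 := ⟨(x-1).toNat, by omega⟩
    have e1 := gc (j+2) (by omega)
    have e2 := gc j (by omega)
    have e3 := hc j
    push_cast at e1
    rw [show (j:ℤ)+1+1 = j+2 by ring, show (j:ℤ)+1-1 = j by ring, e1, e2, e3]
    rw [add_right_comm, two, zero_add]
  have main : ∀ n : ℕ, (n ≤ M → ∀ x : ℤ, 0 ≤ x → x ≤ M →
      f x n = g (x+n) + g (x-n) ∧ f x (n+1) = g (x+(n+1)) + g (x-(n+1))) := by
    intro n
    induction n with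
    | zero =>
      intro _ x h0 h1
      refine ⟨by simp [hy0, two], ?_⟩
      have := g1 x h0 h1
      simp [this]
    | succ n ih =>
      intro hn x h0 h1
      have ih := ih (by omega)
      refine ⟨by have := (ih x h0 h1).2; push_cast; exact this, ?_⟩
      push_cast
      rcases h0.eq_or_lt with rfl | h0
      · rw [hx0, zero_add, zero_sub, geven, two]
      rcases h1.eq_or_lt with rfl | h1
      · rw [hxM, gM, two]
      have e := hf x (n+1) h0 h1 (by omega) (by omega)
      rw [(ih (x+1) (by omega) (by omega)).2, (ih (x-1) (by omega) (by omega)).2,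
        show (n:ℤ)+1-1 = n by ring, (ih x h0.le h1.le).1,
        show x + 1 + ((n:ℤ)+1) = x + (n+1+1) by ring,
        show x + 1 - ((n:ℤ)+1) = x - n by ring,
        show x - 1 + ((n:ℤ)+1) = x + n by ring,
        show x - 1 - ((n:ℤ)+1) = x - (n+1+1) by ring] at e
      generalize g (x + (n+1+1)) = a at *
      generalize g (x - n) = b at *
      generalize g (x + n) = c' at *
      generalize g (x - (n+1+1)) = d at *
      generalize f x (n+1+1) = z at *
      revert e; clear * -; revert a b c' d z; decide
  have hN : ∀ x : ℤ, 0 ≤ x → x ≤ M → g (x + (M+1)) = g (x - (M+1)) := by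
    intro x h0 h1
    have := (main M le_rfl x h0 h1).2
    rw [hyN] at this
    exact eq_of _ _ this.symm
  have gperk : ∀ (k : ℤ) x, g (x + 2 * M * k) = g x := by
    intro k
    induction k using Int.induction_on with
    | zero => simp
    | succ i ih => intro x; rw [← ih x, ← gper (x + 2 * M * i)]; congr 1; ring
    | pred i ih => intro x; rw [← ih x, ← gper (x + 2 * M * (-i-1))]; congr 1; ring
  have hN' : ∀ x : ℤ, g (x + (M+1)) = g (x - (M+1)) := by
    intro x
    have hpos : (0:ℤ) < 2 * M := by omega
    have h1 := Int.emod_nonneg x hpos.ne'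
    have h2 := Int.emod_lt_of_pos x hpos
    have h3 := Int.mul_ediv_add_emod x (2*M)
    generalize x % (2*M) = r at *
    generalize x / (2*M) = q at *
    have e1 : g (x + (M+1)) = g (r + (M+1)) := by
      rw [← gperk q (r + (M+1))]; congr 1; linear_combination -h3
    have e2 : g (x - (M+1)) = g (r - (M+1)) := by
      rw [← gperk q (r - (M+1))]; congr 1; linear_combination -h3
    rw [e1, e2]
    by_cases hr : r ≤ M
    · exact hN r h1 hr
    · have := hN (2*M - r) (by omega) (by omega)
      rw [← geven (r + (M+1)), ← gper, ← geven (r - (M+1)), ← gper (-(r - (M+1)))]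
      rw [show -(r + ((M:ℤ)+1)) + 2*M = 2*M - r - (M+1) by ring,
        show -(r - ((M:ℤ)+1)) + 2*M = 2*M - r + (M+1) by ring, this]
  have g2 : ∀ x : ℤ, g (x + 2) = g x := by
    intro x
    have := hN' (x + 2 - (M+1) + 2 * M)
    have e := gper (x+2)
    rw [show x + 2 - ((M:ℤ)+1) + 2*M + (M+1) = x + 2 + 2*M by ring,
      show x + 2 - ((M:ℤ)+1) + 2*M - (M+1) = x by ring] at this
    rw [← e, this]
  have gk : ∀ (n : ℕ) (x : ℤ), g (x + n) = g (x - n) := by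
    intro n
    induction n with
    | zero => simp
    | succ n ih =>
      intro x
      rw [← g2 (x - (n+1 : ℕ)), show x - ((n+1:ℕ):ℤ) + 2 = (x + 1) - n by push_cast; ring,
        ← ih]; congr 1; push_cast; ring
  intro x y h0 h1 h2 h3
  rcases h3.eq_or_lt with rfl | h3
  · exact hyN x
  obtain ⟨n, rfl⟩ : ∃ n : ℕ, y = n := ⟨y.toNat, by omega⟩
  rw [(main n (by omega) x h0 h1).1, gk, two]

theorem Adjacent.symm' {a b : ℤ × ℤ} (h : Adjacent a b) : Adjacent b a := by
  unfold Adjacent at *; omega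

theorem Adjacent.ne' {a b : ℤ × ℤ} (h : Adjacent a b) : a ≠ b := by
  rintro rfl; unfold Adjacent at h; omega

theorem pair_tiling_ex (R : Set (ℤ × ℤ)) (T : Set (Set (ℤ × ℤ))) (hT : IsDominoTiling R T)
    (i : R) : ∃ j : R, Adjacent i j ∧ ({(i : ℤ × ℤ), (j : ℤ × ℤ)} : Set (ℤ × ℤ)) ∈ T := by
  obtain ⟨h1, h2, h3⟩ := hT
  have hi : (i : ℤ × ℤ) ∈ ⋃₀ T := h3 ▸ i.2
  obtain ⟨d, hd, hid⟩ := hi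
  obtain ⟨a, b, hab, rfl⟩ := h1 d hd
  have ha : a ∈ R := h3 ▸ ⟨_, hd, by simp⟩
  have hb : b ∈ R := h3 ▸ ⟨_, hd, by simp⟩
  rcases hid with h | h
  · exact ⟨⟨b, hb⟩, by rw [h]; exact hab, by rw [h]; exact hd⟩
  · have h : (i : ℤ × ℤ) = b := h
    exact ⟨⟨a, ha⟩, by rw [h]; exact hab.symm', by rw [h, Set.pair_comm]; exact hd⟩

theorem pair_tiling_uniq (R : Set (ℤ × ℤ)) (T : Set (Set (ℤ × ℤ))) (hT : IsDominoTiling R T)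
    (i j k : ℤ × ℤ) (hij : i ≠ j)
    (h1 : ({i, j} : Set (ℤ × ℤ)) ∈ T) (h2 : ({i, k} : Set (ℤ × ℤ)) ∈ T) : j = k := by
  have : ({i, j} : Set (ℤ × ℤ)) = {i, k} := by
    by_contra hne
    have := hT.2.1 h1 h2 hne
    exact (Set.disjoint_left.1 this : ∀ ⦃a⦄, a ∈ ({i, j} : Set (ℤ × ℤ)) → a ∉ ({i, k} : Set (ℤ × ℤ))) (Set.mem_insert i _) (Set.mem_insert i _)
  have hj : j ∈ ({i, k} : Set (ℤ × ℤ)) := this ▸ (by simp)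
  rcases hj with h | h
  · exact absurd h.symm hij
  · exact h

theorem tilings_card (R : Set (ℤ × ℤ)) : numTilings R =
    Nat.card {σ : Equiv.Perm R // (∀ i : R, Adjacent i (σ i)) ∧ ∀ i, σ (σ i) = i} := by
  symm
  have tl : ∀ σ : Equiv.Perm R, (∀ i : R, Adjacent i (σ i)) → (∀ i, σ (σ i) = i) →
      IsDominoTiling R (Set.range fun i : R => {(i : ℤ × ℤ), (σ i : ℤ × ℤ)}) := by
    intro σ h1 h2
    refine ⟨?_, ?_, ?_⟩
    · rintro _ ⟨i, rfl⟩; exact ⟨_, _, h1 i, rfl⟩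
    · rintro _ ⟨i, rfl⟩ _ ⟨j, rfl⟩ hne
      simp only [Function.onFun, id]
      rw [Set.disjoint_left]
      rintro x hx hx'
      apply hne
      simp only [Set.mem_insert_iff, Set.mem_singleton_iff] at hx hx'
      rcases hx with rfl | rfl <;> rcases hx' with h | h <;> have h := Subtype.ext h
      · rw [h]
      · simp only [h, h2]; rw [Set.pair_comm]
      · simp only [← h, h2]; rw [Set.pair_comm]
      · rw [σ.injective h]
    · ext x
      constructor
      · rintro ⟨_, ⟨i, rfl⟩, rfl | rfl⟩
        · exact i.2
        · exact (σ i).2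
      · intro hx; exact ⟨_, ⟨⟨x, hx⟩, rfl⟩, by simp⟩
  refine Nat.card_eq_of_bijective (fun σ => ⟨_, tl σ.1 σ.2.1 σ.2.2⟩) ⟨?_, ?_⟩
  · rintro ⟨σ, h1, h2⟩ ⟨τ, h3, h4⟩ h
    simp only [Subtype.mk.injEq] at h
    apply Subtype.ext
    ext1 i
    apply Subtype.ext
    refine pair_tiling_uniq R _ (tl σ h1 h2) i (σ i) (τ i) (h1 i).ne' ⟨i, rfl⟩ ?_
    rw [h]; exact ⟨i, rfl⟩
  · rintro ⟨T, hT⟩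
    choose s hs1 hs2 using pair_tiling_ex R T hT
    have hinv : ∀ i, s (s i) = i := by
      intro i
      apply Subtype.ext
      refine pair_tiling_uniq R T hT (s i) _ _ (hs1 _).ne' (hs2 _) ?_
      rw [Set.pair_comm]; exact hs2 i
    refine ⟨⟨⟨s, s, hinv, hinv⟩, hs1, hinv⟩, ?_⟩
    apply Subtype.ext
    ext d
    constructor
    · rintro ⟨i, rfl⟩; exact hs2 i
    · intro hd
      obtain ⟨a, b, hab, rfl⟩ := hT.1 d hd
      have ha : a ∈ R := hT.2.2 ▸ ⟨_, hd, by simp⟩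
      refine ⟨⟨a, ha⟩, ?_⟩
      have := pair_tiling_uniq R T hT a _ b (hs1 ⟨a, ha⟩).ne' (hs2 ⟨a, ha⟩) hd
      simp [this]

open Classical in
theorem tilings_det (R : Set (ℤ × ℤ)) [Fintype R] :
    (numTilings R : ZMod 2) =
      (Matrix.of fun i j : R => if Adjacent i j then (1 : ZMod 2) else 0).det := by
  rw [tilings_card, Matrix.det_apply]
  have e : ∀ σ : Equiv.Perm R, Equiv.Perm.sign σ • ∏ i, (Matrix.of fun i j : R =>
      if Adjacent i j then (1 : ZMod 2) else 0) (σ i) i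
      = if ∀ i : R, Adjacent i (σ i) then (1 : ZMod 2) else 0 := by
    intro σ
    have h1 : ∀ z : ZMod 2, Equiv.Perm.sign σ • z = z := by
      intro z
      rcases Int.units_eq_one_or (Equiv.Perm.sign σ) with h | h
      · simp [h]
      · rw [h]; revert z; decide
    rw [h1]
    simp only [Matrix.of_apply]
    rw [Finset.prod_ite_zero]
    simp only [Finset.prod_const_one, Finset.mem_univ, true_imp_iff]
    congr 1
    exact propext ⟨fun h i => (h i).symm', fun h i => (h i).symm'⟩
  rw [Finset.sum_congr rfl fun σ _ => e σ, Finset.sum_boole]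
  rw [← Fintype.card_subtype]
  let S := {σ : Equiv.Perm R // ∀ i : R, Adjacent i (σ i)}
  have hinv : ∀ σ : S, ∀ i : R, Adjacent i (σ.1⁻¹ i) := by
    intro σ i
    have := σ.2 (σ.1⁻¹ i)
    rw [show σ.1 (σ.1⁻¹ i) = i from σ.1.apply_symm_apply i] at this
    exact this.symm'
  let F : Function.End S := fun σ => ⟨σ.1⁻¹, hinv σ⟩
  have hF : F ^ (2 ^ 1) = 1 := by
    rw [pow_one, pow_two]
    funext σ
    exact Subtype.ext (inv_inv σ.1)
  haveI : Fact (Nat.Prime 2) := ⟨Nat.prime_two⟩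
  have key := Equiv.Perm.card_fixedPoints_modEq hF
  have key2 := (ZMod.natCast_eq_natCast_iff _ _ _).2 key
  rw [show Fintype.card {σ : Equiv.Perm R // ∀ i : R, Adjacent i (σ i)} = Fintype.card S from
    rfl, key2, ← Nat.card_eq_fintype_card]
  congr 1
  have fx : ∀ σ : S, σ ∈ Function.fixedPoints F ↔ ∀ i, σ.1 (σ.1 i) = i := by
    intro σ
    have : σ ∈ Function.fixedPoints F ↔ σ.1⁻¹ = σ.1 :=
      ⟨fun h => congrArg Subtype.val h, fun h => Subtype.ext h⟩
    rw [this]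
    constructor
    · intro h i
      conv_lhs => rw [← h]
      rw [h]
      nth_rewrite 1 [← h]
      simp
    · intro h
      ext1 i
      rw [Equiv.Perm.inv_eq_iff_eq, h]
  refine Nat.card_congr ?_
  exact ⟨fun σ => ⟨⟨σ.1, σ.2.1⟩, (fx _).2 σ.2.2⟩, fun σ => ⟨σ.1.1, σ.1.2, (fx _).1 σ.2⟩,
    fun σ => rfl, fun σ => rfl⟩

open Classical in
theorem tilings_odd (k : ℕ) (hk : 1 ≤ k) : numTilings (rectN k (k+1)) % 2 = 1 := by
  have hfin : (rectN k (k+1)).Finite := by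
    apply ((Set.finite_Icc (0:ℤ) k).prod (Set.finite_Icc (0:ℤ) (k+1))).subset
    rintro ⟨x, y⟩ ⟨h1, h2, h3, h4⟩
    simp only [Set.mem_prod, Set.mem_Icc] at *
    push_cast at *
    omega
  haveI : Fintype (rectN k (k+1)) := hfin.fintype
  have h := tilings_det (rectN k (k+1))
  have hd : (Matrix.of fun i j : rectN k (k+1) =>
      if Adjacent i j then (1 : ZMod 2) else 0).det ≠ 0 := by
    intro h0
    obtain ⟨v, hv, hv0⟩ := Matrix.exists_mulVec_eq_zero_iff.2 h0
    apply hv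
    let w : ℤ × ℤ → ZMod 2 := fun q => if hq : q ∈ rectN k (k+1) then v ⟨q, hq⟩ else 0
    have wout : ∀ q, q ∉ rectN k (k+1) → w q = 0 := fun q hq => dif_neg hq
    have hsum : ∀ x y : ℤ, (x, y) ∈ rectN k (k+1) →
        w (x+1, y) + w (x-1, y) + w (x, y+1) + w (x, y-1) = 0 := by
      intro x y hxy
      have e := congrFun hv0 ⟨(x, y), hxy⟩
      simp only [Matrix.mulVec, dotProduct, Matrix.of_apply, Pi.zero_apply, ite_mul, one_mul,
        zero_mul] at e
      rw [← e]
      have e2 : ∀ j : rectN k (k+1), (if Adjacent (x, y) j then v j else 0) =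
          (fun q : ℤ × ℤ => if Adjacent (x, y) q then w q else 0) j := by
        intro j
        simp [w]
      rw [Finset.sum_congr rfl fun j _ => e2 j]
      have e3 : ∑ j : rectN k (k+1), (fun q : ℤ × ℤ => if Adjacent (x, y) q then w q else 0) j
          = ∑ q ∈ ({(x+1, y), (x-1, y), (x, y+1), (x, y-1)} : Finset (ℤ × ℤ)), w q := by
        rw [Finset.sum_set_coe (rectN k (k+1))
          (f := fun q : ℤ × ℤ => if Adjacent (x, y) q then w q else 0), ← Finset.sum_filter]
        apply Finset.sum_subset
        · rintro ⟨a, b⟩ hq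
          have hq := (Finset.mem_filter.1 hq).2
          simp only [Adjacent] at hq
          simp only [Finset.mem_insert, Finset.mem_singleton, Prod.mk.injEq]
          omega
        · rintro ⟨a, b⟩ hq hq'
          apply wout
          intro hR
          apply hq'
          simp only [Finset.mem_insert, Finset.mem_singleton, Prod.mk.injEq] at hq
          exact Finset.mem_filter.2 ⟨Set.mem_toFinset.2 hR, by simp only [Adjacent]; omega⟩
      rw [e3, Finset.sum_insert, Finset.sum_insert, Finset.sum_insert, Finset.sum_singleton]
      · ring
      all_goals
        simp only [Finset.mem_insert, Finset.mem_singleton, Prod.mk.injEq]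
        omega
    have hz := kernel_zero (k+1) (by omega) (fun x y => w (x-1, y-1))
      (fun y => wout _ (by simp [rectN])) (fun y => wout _ (by simp [rectN]))
      (fun x => wout _ (by simp [rectN]))
      (fun x => wout _ (by simp [rectN]))
      (by
        intro x y h1 h2 h3 h4
        have := hsum (x-1) (y-1) (by simp only [rectN, Set.mem_ofPred_eq]; push_cast at *; omega)
        rw [show x + 1 - 1 = x - 1 + 1 by ring, show y + 1 - 1 = y - 1 + 1 by ring]
        exact this)
    funext ⟨⟨x, y⟩, hq⟩
    have hq' := hq
    simp only [rectN, Set.mem_ofPred_eq] at hq'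
    push_cast at hq'
    have := hz (x+1) (y+1) (by omega) (by push_cast; omega) (by omega) (by push_cast; omega)
    simp only [add_sub_cancel_right] at this
    simpa [w, hq] using this
  rw [← h] at hd
  have : ¬ (2 ∣ numTilings (rectN k (k+1))) := fun h => hd ((ZMod.natCast_eq_zero_iff _ _).2 h)
  omega

theorem rect_succ_parity (k : ℕ) (hk : 1 < k) :
    numTilings (rectN k (k + 1)) % 2 = numTilings (rectN (k - 1) k) % 2 := by
  obtain ⟨j, rfl⟩ : ∃ j, k = j + 1 := ⟨k - 1, by omega⟩
  rw [tilings_odd _ (by omega), Nat.add_sub_cancel, tilings_odd j (by omega)]
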